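/- Each of the 2(n+3) dihedral maps μ ∈ {ρ_k, τ_k : k ∈ ℤ/(n+3)ℤ} sends internal diagonals of P to internal diagonals and preserves the crossing relation, so that μ(T) := {{μ(a), μ(b)} : {a,b} ∈ T} is a triangulation of P for every triangulation T. Moreover, for every triangulation T of P and every j ∈ [n+1], Σ_{k ∈ ℤ/(n+3)ℤ} ( x_j(ρ_k(T)) + x_j(τ_k(T)) ) = (n+2)(n+3); equivalently, the barycenter of the 2(n+3) points x(μ(T)) is ((n+2)/2, …, (n+2)/2). -/

import Mathlib

attribute [local instance] Classical.propDecidable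

noncomputable section

namespace Spines

/-- Position of vertex `v ∈ {0,…,n+2}` in the counterclockwise boundary cyclic order:
`0`, then the elements of `D` in increasing order, then `n+2`, then the elements of `U`
in decreasing order. -/
def pos (n : ℕ) (D U : Finset ℕ) (v : ℕ) : ℕ :=
  if v = 0 then 0
  else if v = n + 2 then D.card + 1
  else if v ∈ D then 1 + (D.filter (fun d => d < v)).card
  else D.card + 2 + (U.filter (fun u => v < u)).card

/-- Cyclic distance from `a` to `v` in counterclockwise direction. -/
def relpos (n : ℕ) (D U : Finset ℕ) (a v : ℕ) : ℕ :=
  (pos n D U v + (n + 3) - pos n D U a) % (n + 3)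

/-- `v` lies strictly inside the counterclockwise boundary arc from `a` to `b`. -/
def StrictBetween (n : ℕ) (D U : Finset ℕ) (a b v : ℕ) : Prop :=
  v ≤ n + 2 ∧ 0 < relpos n D U a v ∧ relpos n D U a v < relpos n D U a b

/-- A diagonal, encoded as an ordered pair `(a,b)` with `a < b ≤ n+2`. -/
def IsDiag (n : ℕ) (δ : ℕ × ℕ) : Prop := δ.1 < δ.2 ∧ δ.2 ≤ n + 2

/-- A boundary edge: the endpoints are adjacent in the cyclic order. -/
def IsBoundaryEdge (n : ℕ) (D U : Finset ℕ) (δ : ℕ × ℕ) : Prop :=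
  IsDiag n δ ∧ (relpos n D U δ.1 δ.2 = 1 ∨ relpos n D U δ.2 δ.1 = 1)

/-- An internal diagonal. -/
def IsInternalDiag (n : ℕ) (D U : Finset ℕ) (δ : ℕ × ℕ) : Prop :=
  IsDiag n δ ∧ ¬ IsBoundaryEdge n D U δ

/-- Two diagonals cross: the four endpoints are pairwise distinct and exactly one
endpoint of the second lies strictly inside each of the two arcs determined by the first. -/
def Cross (n : ℕ) (D U : Finset ℕ) (δ δ' : ℕ × ℕ) : Prop :=
  δ.1 ≠ δ.2 ∧ δ'.1 ≠ δ'.2 ∧ δ.1 ≠ δ'.1 ∧ δ.1 ≠ δ'.2 ∧ δ.2 ≠ δ'.1 ∧ δ.2 ≠ δ'.2 ∧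
  ((StrictBetween n D U δ.1 δ.2 δ'.1 ∧ StrictBetween n D U δ.2 δ.1 δ'.2) ∨
   (StrictBetween n D U δ.1 δ.2 δ'.2 ∧ StrictBetween n D U δ.2 δ.1 δ'.1))

/-- A triangulation: a maximal set of pairwise non-crossing internal diagonals. -/
def IsTriangulation (n : ℕ) (D U : Finset ℕ) (T : Finset (ℕ × ℕ)) : Prop :=
  (∀ δ ∈ T, IsInternalDiag n D U δ) ∧
  (∀ δ ∈ T, ∀ δ' ∈ T, ¬ Cross n D U δ δ') ∧
  (∀ δ, IsInternalDiag n D U δ → δ ∉ T → ∃ δ' ∈ T, Cross n D U δ δ')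

/-- `a` and `b` (with `a < b`) are joined by a diagonal of `T` or a boundary edge. -/
def EdgeOf (n : ℕ) (D U : Finset ℕ) (T : Finset (ℕ × ℕ)) (a b : ℕ) : Prop :=
  (a, b) ∈ T ∨ IsBoundaryEdge n D U (a, b)

/-- `{i,j,k}` with `i<j<k` is a triangle of the triangulation `T`. -/
def IsTriangleOf (n : ℕ) (D U : Finset ℕ) (T : Finset (ℕ × ℕ)) (i j k : ℕ) : Prop :=
  i < j ∧ j < k ∧ k ≤ n + 2 ∧
    EdgeOf n D U T i j ∧ EdgeOf n D U T j k ∧ EdgeOf n D U T i k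

/-- `Bel δ`: labels in `[n+1]` strictly inside the ccw arc from `δ.1` to `δ.2`,
together with the endpoints of `δ` lying in `U`. -/
def Bel (n : ℕ) (D U : Finset ℕ) (δ : ℕ × ℕ) : Finset ℕ :=
  (Finset.Icc 1 (n + 1)).filter
    (fun j => StrictBetween n D U δ.1 δ.2 j ∨ (j ∈ U ∧ (j = δ.1 ∨ j = δ.2)))

def bel (n : ℕ) (D U : Finset ℕ) (δ : ℕ × ℕ) : ℕ := (Bel n D U δ).card

def Abo (n : ℕ) (D U : Finset ℕ) (δ : ℕ × ℕ) : Finset ℕ :=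
  Finset.Icc 1 (n + 1) \ Bel n D U δ

/-- The coordinates of the point `x(T)` associated to a triangulation `T`. -/
def xcoord (n : ℕ) (D U : Finset ℕ) (T : Finset (ℕ × ℕ)) (j : ℕ) : ℝ :=
  if h : ∃ p : ℕ × ℕ, IsTriangleOf n D U T p.1 j p.2 then
    if j ∈ D then
      ((bel n D U (h.choose.1, j) : ℝ) + 1) * ((bel n D U (j, h.choose.2) : ℝ) + 1)
    else
      ((n : ℝ) + 2) -
        (((n : ℝ) + 2) - (bel n D U (h.choose.1, j) : ℝ)) *
          (((n : ℝ) + 2) - (bel n D U (j, h.choose.2) : ℝ))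
  else 0

/-- Middle vertex of the triple `{a,b,c}` with `a < b` and `c ∉ {a,b}`. -/
def midOf (a b c : ℕ) : ℕ := if c < a then a else if c < b then c else b

/-- `c` is the third vertex of a triangle of `T` containing the diagonal `δ`. -/
def TriWith (n : ℕ) (D U : Finset ℕ) (T : Finset (ℕ × ℕ)) (δ : ℕ × ℕ) (c : ℕ) : Prop :=
  if c < δ.1 then IsTriangleOf n D U T c δ.1 δ.2
  else if c < δ.2 then IsTriangleOf n D U T δ.1 c δ.2
  else IsTriangleOf n D U T δ.1 δ.2 c

/-- `s_δ`: middle vertex of the triangle of `T` below `δ` (third vertex strictly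
inside the ccw arc from `δ.1` to `δ.2`). -/
def spineSrc (n : ℕ) (D U : Finset ℕ) (T : Finset (ℕ × ℕ)) (δ : ℕ × ℕ) : ℕ :=
  if h : ∃ c, StrictBetween n D U δ.1 δ.2 c ∧ TriWith n D U T δ c then
    midOf δ.1 δ.2 h.choose
  else 0

/-- `t_δ`: middle vertex of the triangle of `T` above `δ` (third vertex strictly
inside the ccw arc from `δ.2` to `δ.1`). -/
def spineTgt (n : ℕ) (D U : Finset ℕ) (T : Finset (ℕ × ℕ)) (δ : ℕ × ℕ) : ℕ :=
  if h : ∃ c, StrictBetween n D U δ.2 δ.1 c ∧ TriWith n D U T δ c then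
    midOf δ.1 δ.2 h.choose
  else 0

/-- `(p,q)` is an arc of the spine of `T`. -/
def SpineArc (n : ℕ) (D U : Finset ℕ) (T : Finset (ℕ × ℕ)) (p q : ℕ) : Prop :=
  ∃ δ ∈ T, spineSrc n D U T δ = p ∧ spineTgt n D U T δ = q

/-- The finite set of all triangulations of the polygon. -/
def allTri (n : ℕ) (D U : Finset ℕ) : Finset (Finset (ℕ × ℕ)) :=
  ((Finset.range (n + 3) ×ˢ Finset.range (n + 3)).filter
      (fun δ => IsInternalDiag n D U δ)).powerset.filter
    (fun T => IsTriangulation n D U T)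

end Spines

namespace Spines

/-- `β : ℤ/(n+3)ℤ → {0,…,n+2}`, the enumeration of the counterclockwise boundary
cyclic order (the inverse of `pos`). -/
def betaFn (n : ℕ) (D U : Finset ℕ) (k : ZMod (n + 3)) : ℕ :=
  if h : ∃ v : ℕ, v ≤ n + 2 ∧ pos n D U v = k.val then h.choose else 0

/-- The rotation `ρ_k(v) = β(β⁻¹(v) + k)`. -/
def rotMap (n : ℕ) (D U : Finset ℕ) (k : ZMod (n + 3)) (v : ℕ) : ℕ :=
  betaFn n D U ((pos n D U v : ZMod (n + 3)) + k)

/-- The reflection `τ_k(v) = β(k − β⁻¹(v))`. -/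
def reflMap (n : ℕ) (D U : Finset ℕ) (k : ZMod (n + 3)) (v : ℕ) : ℕ :=
  betaFn n D U (k - (pos n D U v : ZMod (n + 3)))

/-- Image of a diagonal `{a,b}` under a vertex map, re-sorted as an ordered pair. -/
def mapDiag (f : ℕ → ℕ) (δ : ℕ × ℕ) : ℕ × ℕ :=
  (min (f δ.1) (f δ.2), max (f δ.1) (f δ.2))

/-- Counterclockwise distance from `a` to `b` on the cycle `ZMod N`. -/
def cdist {N : ℕ} (a b : ZMod N) : ℕ := (b - a).val

lemma cdist_lt {N : ℕ} [NeZero N] (a b : ZMod N) : cdist a b < N := ZMod.val_lt _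

lemma cdist_eq_zero {N : ℕ} {a b : ZMod N} : cdist a b = 0 ↔ a = b := by
  rw [cdist, ZMod.val_eq_zero, sub_eq_zero, eq_comm]

lemma cdist_self {N : ℕ} (a : ZMod N) : cdist a a = 0 := cdist_eq_zero.2 rfl

lemma cdist_inj {N : ℕ} [NeZero N] {a x y : ZMod N} : cdist a x = cdist a y ↔ x = y := by
  refine ⟨fun h => ?_, fun h => h ▸ rfl⟩
  have := ZMod.val_injective N h
  simpa using this

/-- Distances between `x` and `y` in terms of the distances measured from a base point. -/
lemma cdist_rebase {N : ℕ} [NeZero N] (a x y : ZMod N) :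
    (cdist a x ≤ cdist a y ∧ cdist x y + cdist a x = cdist a y) ∨
      (cdist a y < cdist a x ∧ cdist x y + cdist a x = cdist a y + N) := by
  have hsum : cdist a y = (cdist x y + cdist a x) % N := by
    rw [cdist, cdist, cdist, ← ZMod.val_add]
    congr 1
    ring
  have h1 := cdist_lt x y
  have h2 := cdist_lt a x
  rcases lt_or_ge (cdist x y + cdist a x) N with h | h
  · rw [Nat.mod_eq_of_lt h] at hsum
    omega
  · rw [Nat.mod_eq_sub_mod h, Nat.mod_eq_of_lt (by omega)] at hsum
    omega

lemma cdist_add_cdist {N : ℕ} [NeZero N] {a b : ZMod N} (h : a ≠ b) :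
    cdist a b + cdist b a = N := by
  have h1 := cdist_rebase a b a
  have h2 := cdist_self a
  have h3 := mt cdist_eq_zero.1 h
  omega

lemma cdist_zero_left {N : ℕ} (x : ZMod N) : cdist 0 x = x.val := by rw [cdist, sub_zero]

lemma cdist_add_one {N : ℕ} (hN : 1 < N) (a : ZMod N) : cdist a (a + 1) = 1 := by
  have : Fact (1 < N) := ⟨hN⟩
  rw [cdist, add_sub_cancel_left, ZMod.val_one]

lemma cdist_eq_one {N : ℕ} [NeZero N] (hN : 1 < N) {a b : ZMod N} :
    cdist a b = 1 ↔ b = a + 1 := by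
  rw [← cdist_add_one hN a, cdist_inj]

/-- The edge relation of a triangulation of the convex polygon with vertex set `ZMod N`. -/
structure CyclicTriangulation (N : ℕ) (E : ZMod N → ZMod N → Prop) : Prop where
  symm : ∀ a b, E a b → E b a
  ne : ∀ a b, E a b → a ≠ b
  adj : ∀ a, E a (a + 1)
  noncross : ∀ a b c d, E a c → E b d → 0 < cdist a b → cdist a b < cdist a c →
    cdist a c < cdist a d → False
  maximal : ∀ a b, a ≠ b → ¬ E a b →
    ∃ x y, E x y ∧ 0 < cdist a x ∧ cdist a x < cdist a b ∧ cdist a b < cdist a y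

namespace CyclicTriangulation

variable {N : ℕ} [NeZero N] {E : ZMod N → ZMod N → Prop}

/-- Two consecutive neighbours of a vertex are adjacent. -/
lemma edge_of_consecutive (hE : CyclicTriangulation N E) {a x y : ZMod N}
    (hx : E a x) (hy : E a y) (hxy : cdist a x < cdist a y)
    (hgap : ∀ z, E a z → cdist a x < cdist a z → cdist a z < cdist a y → False) : E x y := by
  by_contra hne
  have hx0 : cdist a x ≠ 0 := mt cdist_eq_zero.1 (hE.ne _ _ hx)
  obtain ⟨u, v, huv, h1, h2, h3⟩ :=
    hE.maximal x y (fun h => by rw [h] at hxy; exact lt_irrefl _ hxy) hne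
  have e1 := cdist_rebase a x u
  have e2 := cdist_rebase a x y
  have e3 := cdist_rebase a x v
  have l1 := cdist_lt a u
  have l2 := cdist_lt a v
  have l3 := cdist_lt a y
  rcases Nat.eq_zero_or_pos (cdist a v) with h0 | h0
  · obtain rfl := cdist_eq_zero.1 h0
    exact hgap u (hE.symm _ _ huv) (by omega) (by omega)
  · rcases lt_or_ge (cdist a v) (cdist a x) with h4 | h4
    · exact hE.noncross a v x u hx (hE.symm _ _ huv) h0 h4 (by omega)
    · exact hE.noncross a u y v hy huv (by omega) (by omega) (by omega)

lemma exists_apex (hE : CyclicTriangulation N E) (hN : 1 < N) {x y : ZMod N}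
    (hxy : E x y) (h : 1 < cdist x y) :
    ∃ c, E x c ∧ E c y ∧ 0 < cdist x c ∧ cdist x c < cdist x y := by
  classical
  let S : Finset (ZMod N) := Finset.univ.filter fun c => E x c ∧ cdist x c < cdist x y
  have hS : S.Nonempty :=
    ⟨x + 1, by simp only [S, Finset.mem_filter, Finset.mem_univ, true_and]
               exact ⟨hE.adj x, by rwa [cdist_add_one hN]⟩⟩
  obtain ⟨c, hc, hmax⟩ := S.exists_max_image (cdist x) hS
  simp only [S, Finset.mem_filter, Finset.mem_univ, true_and] at hc hmax
  refine ⟨c, hc.1, ?_, Nat.pos_of_ne_zero (mt cdist_eq_zero.1 (hE.ne _ _ hc.1)), hc.2⟩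
  exact hE.edge_of_consecutive hc.1 hxy hc.2
    fun z hz h1 h2 => absurd (hmax z ⟨hz, h2⟩) (by omega)

lemma exists_separating (hE : CyclicTriangulation N E) {s s' : ℕ} (hs : 1 ≤ s) (hs' : 1 ≤ s')
    (hN : s + s' + 1 = N) (q : ZMod N) :
    ∃ u v, E q u ∧ E q v ∧ E u v ∧ cdist q u ≤ s ∧ cdist v q ≤ s' := by
  classical
  let S : Finset (ZMod N) := Finset.univ.filter fun c => E q c ∧ cdist q c ≤ s
  let S' : Finset (ZMod N) := Finset.univ.filter fun c => E q c ∧ s < cdist q c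
  have hS : S.Nonempty :=
    ⟨q + 1, by simp only [S, Finset.mem_filter, Finset.mem_univ, true_and]
               exact ⟨hE.adj q, by rwa [cdist_add_one (by omega)]⟩⟩
  have hS' : S'.Nonempty := by
    refine ⟨q - 1, ?_⟩
    have h1 : E (q - 1) q := by simpa using hE.adj (q - 1)
    have h2 : cdist (q - 1) q = 1 := by rw [cdist_eq_one (by omega)]; ring
    have h3 := cdist_add_cdist (hE.ne _ _ h1)
    simp only [S', Finset.mem_filter, Finset.mem_univ, true_and]
    exact ⟨hE.symm _ _ h1, by omega⟩
  obtain ⟨u, hu, hmax⟩ := S.exists_max_image (cdist q) hS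
  obtain ⟨v, hv, hmin⟩ := S'.exists_min_image (cdist q) hS'
  simp only [S, S', Finset.mem_filter, Finset.mem_univ, true_and] at hu hv hmax hmin
  have h3 := cdist_add_cdist (hE.ne _ _ hv.1)
  refine ⟨u, v, hu.1, hv.1, ?_, hu.2, by omega⟩
  refine hE.edge_of_consecutive hu.1 hv.1 (by omega) fun z hz h1 h2 => ?_
  rcases le_or_gt (cdist q z) s with h | h
  · exact absurd (hmax z ⟨hz, h⟩) (by omega)
  · exact absurd (hmin z ⟨hz, h⟩) (by omega)

lemma separating_unique (hE : CyclicTriangulation N E) {s s' : ℕ} (hN : s + s' + 1 = N)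
    {q u v u' v' : ZMod N} (hu : E q u) (hv : E q v) (huv : E u v) (hus : cdist q u ≤ s)
    (hvs : cdist v q ≤ s') (hu' : E q u') (hv' : E q v') (huv' : E u' v')
    (hus' : cdist q u' ≤ s) (hvs' : cdist v' q ≤ s') : u = u' ∧ v = v' := by
  have a1 := cdist_add_cdist (hE.ne _ _ hv)
  have a2 := cdist_add_cdist (hE.ne _ _ hv')
  have b1 := mt cdist_eq_zero.1 (hE.ne _ _ hu)
  have b2 := mt cdist_eq_zero.1 (hE.ne _ _ hu')
  rw [← cdist_inj (a := q) (x := u), ← cdist_inj (a := q) (x := v)]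
  constructor
  · rcases lt_trichotomy (cdist q u) (cdist q u') with h | h | h
    · exact (hE.noncross q u u' v hu' huv (by omega) h (by omega)).elim
    · exact h
    · exact (hE.noncross q u' u v' hu huv' (by omega) h (by omega)).elim
  · rcases lt_trichotomy (cdist q v) (cdist q v') with h | h | h
    · exact (hE.noncross q u' v v' hv huv' (by omega) (by omega) h).elim
    · exact h
    · exact (hE.noncross q u v' v hv' huv (by omega) (by omega) h).elim

end CyclicTriangulation

/-- The weight `d(q,u) · d(v,q)` of the triangle `q, u, v` at `q`, provided that it separates
the `s` vertices following `q` from the `s'` vertices preceding `q`. -/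
def sepWeight {N : ℕ} (E : ZMod N → ZMod N → Prop) (s s' : ℕ) (q u v : ZMod N) : ℝ :=
  if E q u ∧ E q v ∧ E u v ∧ cdist q u ≤ s ∧ cdist v q ≤ s' then
    (cdist q u : ℝ) * cdist v q else 0

lemma CyclicTriangulation.sum_sepWeight {N : ℕ} [NeZero N] {E : ZMod N → ZMod N → Prop}
    (hE : CyclicTriangulation N E) {s s' : ℕ} (hN : s + s' + 1 = N)
    {q u v : ZMod N} (hu : E q u) (hv : E q v) (huv : E u v) (hus : cdist q u ≤ s)
    (hvs : cdist v q ≤ s') :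
    ∑ u, ∑ v, sepWeight E s s' q u v = (cdist q u : ℝ) * cdist v q := by
  rw [Finset.sum_eq_single u, Finset.sum_eq_single v]
  · rw [sepWeight, if_pos ⟨hu, hv, huv, hus, hvs⟩]
  · intro v' _ hne
    refine if_neg fun h => hne ?_
    exact (hE.separating_unique hN h.1 h.2.1 h.2.2.1 h.2.2.2.1 h.2.2.2.2 hu hv huv hus hvs).2
  · simp
  · intro u' _ hne
    refine Finset.sum_eq_zero fun v' _ => if_neg fun h => hne ?_
    exact (hE.separating_unique hN h.1 h.2.1 h.2.2.1 h.2.2.2.1 h.2.2.2.2 hu hv huv hus hvs).1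
  · simp

/-- Product of two arc lengths, truncated at `s` and `s'`. -/
def arcWeight (s s' X Y : ℕ) : ℝ := if X ≤ s ∧ Y ≤ s' then (X : ℝ) * Y else 0

/-- Total weight of a triangle with arc lengths `X, Y, Z`. -/
def triWeight (s s' X Y Z : ℕ) : ℝ :=
  (arcWeight s s' X Z + arcWeight s s' Y X + arcWeight s s' Z Y) +
    (arcWeight s' s X Z + arcWeight s' s Y X + arcWeight s' s Z Y)

/-- Total weight of the triangles cut off by a diagonal spanning an arc of length `m`
in a polygon with `s + s' + 1` vertices, `s ≤ s'`. -/
def cutWeight (s s' m : ℕ) : ℝ :=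
  if m ≤ s then (m : ℝ) * (m - 1)
  else if m ≤ s' then ((s : ℝ) + s') * m
  else ((s : ℝ) + s' + 1) * (s + s') - ((s : ℝ) + s' + 1 - m) * (s + s' - m)

lemma cutWeight_compl {s s' m m' : ℕ} (hs : s ≤ s') (h : m + m' = s + s' + 1) :
    cutWeight s s' m + cutWeight s s' m' = ((s : ℝ) + s' + 1) * (s + s') := by
  have hR : (m : ℝ) + m' = s + s' + 1 := by exact_mod_cast h
  have hm' : (m' : ℝ) = s + s' + 1 - m := by linarith
  unfold cutWeight
  split_ifs <;> first | (exfalso; omega) | (rw [hm']; ring)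

lemma triWeight_eq {s s' X Y Z : ℕ} (hs : s ≤ s') (h : X + Y + Z = s + s' + 1)
    (hX : 0 < X) (hY : 0 < Y) (hZ : 0 < Z) :
    triWeight s s' X Y Z = ((s : ℝ) + s' + 1) * (s + s') -
      cutWeight s s' X - cutWeight s s' Y - cutWeight s s' Z := by
  have hR : (X : ℝ) + Y + Z = s + s' + 1 := by exact_mod_cast h
  have hs' : (s' : ℝ) = X + Y + Z - s - 1 := by linarith
  unfold triWeight cutWeight arcWeight
  have cls : ∀ m : ℕ, (m ≤ s ∧ m ≤ s') ∨ (¬ m ≤ s ∧ m ≤ s') ∨ (¬ m ≤ s ∧ ¬ m ≤ s') := by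
    intro m
    omega
  rcases cls X with ⟨x1, x2⟩ | ⟨x1, x2⟩ | ⟨x1, x2⟩ <;>
  rcases cls Y with ⟨y1, y2⟩ | ⟨y1, y2⟩ | ⟨y1, y2⟩ <;>
  rcases cls Z with ⟨z1, z2⟩ | ⟨z1, z2⟩ | ⟨z1, z2⟩ <;>
  first
  | (exfalso; omega)
  | (simp only [x1, x2, y1, y2, z1, z2, and_self, and_true, and_false, if_true, if_false]
     rw [hs']
     ring)

/-- `x < y < z` is a triangle contained in the interval from `a` to `b`. -/
def IntervalTri {N : ℕ} (E : ZMod N → ZMod N → Prop) (a b : ZMod N)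
    (t : ZMod N × ZMod N × ZMod N) : Prop :=
  a.val ≤ t.1.val ∧ t.1.val < t.2.1.val ∧ t.2.1.val < t.2.2.val ∧ t.2.2.val ≤ b.val ∧
    E t.1 t.2.1 ∧ E t.2.1 t.2.2 ∧ E t.1 t.2.2

lemma CyclicTriangulation.noncross_val {N : ℕ} [NeZero N] {E : ZMod N → ZMod N → Prop}
    (hE : CyclicTriangulation N E) {a b c d : ZMod N} (hac : E a c) (hbd : E b d)
    (h1 : a.val < b.val) (h2 : b.val < c.val) (h3 : c.val < d.val) : False := by
  have e1 := cdist_rebase 0 a b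
  have e2 := cdist_rebase 0 a c
  have e3 := cdist_rebase 0 a d
  simp only [cdist_zero_left] at e1 e2 e3
  exact hE.noncross a b c d hac hbd (by omega) (by omega) (by omega)

lemma CyclicTriangulation.intervalTri_split {N : ℕ} [NeZero N] {E : ZMod N → ZMod N → Prop}
    (hE : CyclicTriangulation N E) {a b c : ZMod N} (hab : E a b) (hac : E a c) (hcb : E c b)
    (h1 : a.val < c.val) (h2 : c.val < b.val) (t : ZMod N × ZMod N × ZMod N) :
    IntervalTri E a b t ↔ IntervalTri E a c t ∨ IntervalTri E c b t ∨ t = (a, c, b) := by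
  obtain ⟨x, y, z⟩ := t
  simp only [IntervalTri, Prod.mk.injEq]
  constructor
  · rintro ⟨hax, hxy, hyz, hzb, e1, e2, e3⟩
    rcases le_or_gt z.val c.val with hz | hz
    · exact Or.inl ⟨hax, hxy, hyz, hz, e1, e2, e3⟩
    rcases le_or_gt c.val x.val with hx | hx
    · exact Or.inr (Or.inl ⟨hx, hxy, hyz, hzb, e1, e2, e3⟩)
    refine Or.inr (Or.inr ?_)
    have hxa : x = a := by
      rcases hax.lt_or_eq with h | h
      · exact (hE.noncross_val hac e3 h hx hz).elim
      · exact (ZMod.val_injective N h).symm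
    have hzb' : z = b := by
      rcases hzb.lt_or_eq with h | h
      · exact (hE.noncross_val e3 hcb hx hz h).elim
      · exact ZMod.val_injective N h
    subst hxa hzb'
    refine ⟨rfl, ?_, rfl⟩
    rcases lt_trichotomy y.val c.val with h | h | h
    · exact (hE.noncross_val hac e2 hxy h hz).elim
    · exact ZMod.val_injective N h
    · exact (hE.noncross_val e1 hcb hx h hyz).elim
  · rintro (⟨hax, hxy, hyz, hzb, e⟩ | ⟨hax, hxy, hyz, hzb, e⟩ | ⟨rfl, rfl, rfl⟩)
    · exact ⟨hax, hxy, hyz, by omega, e⟩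
    · exact ⟨by omega, hxy, hyz, hzb, e⟩
    · exact ⟨le_rfl, h1, h2, le_rfl, hac, hcb, hab⟩

/-- Weight of the triangle `t` in terms of the positions of its vertices. -/
def tripleWeight {N : ℕ} (s s' : ℕ) (t : ZMod N × ZMod N × ZMod N) : ℝ :=
  triWeight s s' (t.2.1.val - t.1.val) (t.2.2.val - t.2.1.val) (N - (t.2.2.val - t.1.val))

lemma CyclicTriangulation.sum_interval {N : ℕ} [NeZero N] {E : ZMod N → ZMod N → Prop}
    (hE : CyclicTriangulation N E) {s s' : ℕ} (hs : 1 ≤ s) (hss : s ≤ s') (hN : s + s' + 1 = N)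
    (m : ℕ) : ∀ a b : ZMod N, E a b → a.val + m = b.val → 0 < m →
      ∑ t, (if IntervalTri E a b t then tripleWeight s s' t else 0) = cutWeight s s' m := by
  induction m using Nat.strong_induction_on with
  | _ m ih =>
  intro a b hab hm hm0
  have hb := ZMod.val_lt b
  rcases Nat.eq_or_lt_of_le (Nat.succ_le_of_lt hm0) with h1 | h1
  · rw [Finset.sum_eq_zero, cutWeight, if_pos (by omega), ← h1]
    · norm_num
    · rintro ⟨x, y, z⟩ -
      refine if_neg ?_
      rintro ⟨h1, h2, h3, h4, -⟩
      simp only at h1 h2 h3 h4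
      omega
  · have eb := cdist_rebase 0 a b
    simp only [cdist_zero_left] at eb
    obtain ⟨c, hac, hcb, hc0, hc⟩ := hE.exists_apex (by omega) hab (by omega)
    have ec := cdist_rebase 0 a c
    simp only [cdist_zero_left] at ec
    have hcl := ZMod.val_lt c
    have hac' : a.val < c.val := by omega
    have hcb' : c.val < b.val := by omega
    have key : ∀ t, (if IntervalTri E a b t then tripleWeight s s' t else 0) =
        (if IntervalTri E a c t then tripleWeight s s' t else 0) +
        ((if IntervalTri E c b t then tripleWeight s s' t else 0) +
        (if t = (a, c, b) then tripleWeight s s' t else 0)) := by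
      intro t
      have h := hE.intervalTri_split hab hac hcb hac' hcb' t
      have d1 : IntervalTri E a c t → ¬ IntervalTri E c b t := by
        rintro ⟨_, _, _, _, _⟩ ⟨_, _, _, _, _⟩
        omega
      have d2 : IntervalTri E a c t → t ≠ (a, c, b) := by
        rintro ⟨_, _, _, _, _⟩ rfl
        simp only at *
        omega
      have d3 : IntervalTri E c b t → t ≠ (a, c, b) := by
        rintro ⟨_, _, _, _, _⟩ rfl
        simp only at *
        omega
      by_cases p1 : IntervalTri E a c t
      · rw [if_pos (h.2 (Or.inl p1)), if_pos p1, if_neg (d1 p1), if_neg (d2 p1)]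
        ring
      · by_cases p2 : IntervalTri E c b t
        · rw [if_pos (h.2 (Or.inr (Or.inl p2))), if_neg p1, if_pos p2, if_neg (d3 p2)]
          ring
        · by_cases p3 : t = (a, c, b)
          · rw [if_pos (h.2 (Or.inr (Or.inr p3))), if_neg p1, if_neg p2, if_pos p3]
            ring
          · rw [if_neg (fun q => by rcases h.1 q with q | q | q <;> contradiction), if_neg p1,
              if_neg p2, if_neg p3]
            ring
    rw [Finset.sum_congr rfl fun t _ => key t, Finset.sum_add_distrib, Finset.sum_add_distrib,
      ih (c.val - a.val) (by omega) a c hac (by omega) (by omega),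
      ih (b.val - c.val) (by omega) c b hcb (by omega) (by omega),
      Finset.sum_ite_eq' Finset.univ (a, c, b) (tripleWeight s s'), if_pos (Finset.mem_univ _)]
    simp only [tripleWeight]
    rw [triWeight_eq hss (by omega) (by omega) (by omega) (by omega)]
    have := cutWeight_compl (m := m) (m' := N - (b.val - a.val)) hss (by omega)
    linarith

/-- A sum over triples supported on cyclically ordered triples, grouped by triangles. -/
lemma sum_cyclic_triples {N : ℕ} [NeZero N] (ψ : ZMod N → ZMod N → ZMod N → ℝ)
    (hψ : ∀ q u v, ¬ (q.val < u.val ∧ u.val < v.val) → ¬ (u.val < v.val ∧ v.val < q.val) →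
      ¬ (v.val < q.val ∧ q.val < u.val) → ψ q u v = 0) :
    ∑ q, ∑ u, ∑ v, ψ q u v = ∑ t : ZMod N × ZMod N × ZMod N,
      (if t.1.val < t.2.1.val ∧ t.2.1.val < t.2.2.val then
        ψ t.1 t.2.1 t.2.2 + ψ t.2.1 t.2.2 t.1 + ψ t.2.2 t.1 t.2.1 else 0) := by
  have key : ∀ q u v, ψ q u v =
      (if q.val < u.val ∧ u.val < v.val then ψ q u v else 0) +
      ((if v.val < q.val ∧ q.val < u.val then ψ q u v else 0) +
       (if u.val < v.val ∧ v.val < q.val then ψ q u v else 0)) := by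
    intro q u v
    by_cases h1 : q.val < u.val ∧ u.val < v.val
    · rw [if_pos h1, if_neg (by omega), if_neg (by omega)]
      ring
    · by_cases h2 : v.val < q.val ∧ q.val < u.val
      · rw [if_neg h1, if_pos h2, if_neg (by omega)]
        ring
      · by_cases h3 : u.val < v.val ∧ v.val < q.val
        · rw [if_neg h1, if_neg h2, if_pos h3]
          ring
        · rw [if_neg h1, if_neg h2, if_neg h3, hψ q u v h1 h3 h2]
          ring
  have split : ∀ (p : Prop) [Decidable p] (a b c : ℝ), (if p then a + b + c else 0) =
      (if p then a else 0) + ((if p then b else 0) + (if p then c else 0)) := by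
    intro p _ a b c
    split_ifs <;> ring
  rw [Fintype.sum_prod_type]
  simp only [Fintype.sum_prod_type, split, Finset.sum_add_distrib]
  rw [Finset.sum_congr rfl fun q _ => Finset.sum_congr rfl fun u _ =>
    Finset.sum_congr rfl fun v _ => key q u v]
  simp only [Finset.sum_add_distrib]
  congr 2
  · rw [Finset.sum_congr rfl fun q _ => Finset.sum_comm, Finset.sum_comm]
  · rw [Finset.sum_comm, Finset.sum_congr rfl fun q _ => Finset.sum_comm]

lemma CyclicTriangulation.sum_sepWeight_add {N : ℕ} [NeZero N] {E : ZMod N → ZMod N → Prop}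
    (hE : CyclicTriangulation N E) {s s' : ℕ} (hs : 1 ≤ s) (hs' : 1 ≤ s')
    (hN : s + s' + 1 = N) :
    ∑ q, ∑ u, ∑ v, (sepWeight E s s' q u v + sepWeight E s' s q u v) = (N : ℝ) * (N - 1) := by
  wlog hss : s ≤ s' generalizing s s'
  · rw [← this hs' hs (by omega) (by omega)]
    simp only [add_comm]
  have hpos := fun {a b : ZMod N} (h : E a b) => mt cdist_eq_zero.1 (hE.ne _ _ h)
  rw [sum_cyclic_triples]
  · have hlast : E 0 (-1) := hE.symm _ _ (by simpa using hE.adj (-1))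
    have hval : (0 : ZMod N).val + (N - 1) = (-1 : ZMod N).val := by
      have h1 : cdist (-1 : ZMod N) 0 = 1 := by rw [cdist_eq_one (by omega)]; ring
      have h2 := cdist_add_cdist (hE.ne _ _ hlast)
      rw [cdist_zero_left] at h2
      rw [ZMod.val_zero]
      omega
    have htot := hE.sum_interval hs hss hN (N - 1) 0 (-1) hlast hval (by omega)
    have hcut : cutWeight s s' (N - 1) = (N : ℝ) * (N - 1) := by
      have h := cutWeight_compl (m := N - 1) (m' := 1) hss (by omega)
      have h1 : cutWeight s s' 1 = 0 := by
        rw [cutWeight, if_pos hs]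
        norm_num
      have hR : (N : ℝ) = s + s' + 1 := by exact_mod_cast hN.symm
      rw [hR]
      linarith
    rw [← hcut, ← htot]
    refine Finset.sum_congr rfl ?_
    rintro ⟨x, y, z⟩ -
    simp only
    have hz := ZMod.val_lt z
    by_cases hord : x.val < y.val ∧ y.val < z.val
    · rw [if_pos hord]
      have e1 := cdist_rebase 0 x y
      have e2 := cdist_rebase 0 y z
      have e3 := cdist_rebase 0 z x
      simp only [cdist_zero_left] at e1 e2 e3
      have d1 : cdist x y = y.val - x.val := by omega
      have d2 : cdist y z = z.val - y.val := by omega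
      have d3 : cdist z x = N - (z.val - x.val) := by omega
      by_cases htri : E x y ∧ E y z ∧ E x z
      · obtain ⟨h1, h2, h3⟩ := htri
        have h1' := hE.symm _ _ h1
        have h2' := hE.symm _ _ h2
        have h3' := hE.symm _ _ h3
        rw [if_pos ⟨by simp, hord.1, hord.2, by simp only [← hval, ZMod.val_zero]; omega,
          h1, h2, h3⟩]
        simp only [sepWeight, h1, h2, h3, h1', h2', h3', true_and, d1, d2, d3, tripleWeight,
          triWeight, arcWeight]
        ring
      · rw [if_neg fun h => htri h.2.2.2.2]
        have f1 : ∀ r r' : ℕ, sepWeight E r r' x y z = 0 := fun r r' =>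
          if_neg fun h => htri ⟨h.1, h.2.2.1, h.2.1⟩
        have f2 : ∀ r r' : ℕ, sepWeight E r r' y z x = 0 := fun r r' =>
          if_neg fun h => htri ⟨hE.symm _ _ h.2.1, h.1, hE.symm _ _ h.2.2.1⟩
        have f3 : ∀ r r' : ℕ, sepWeight E r r' z x y = 0 := fun r r' =>
          if_neg fun h => htri ⟨h.2.2.1, hE.symm _ _ h.2.1, hE.symm _ _ h.1⟩
        simp only [f1, f2, f3, add_zero]
    · rw [if_neg hord, if_neg fun h => hord ⟨h.2.1, h.2.2.1⟩]
  · intro q u v h1 h2 h3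
    have e1 := cdist_rebase 0 q u
    have e2 := cdist_rebase 0 v q
    have e3 := cdist_rebase 0 u v
    simp only [cdist_zero_left] at e1 e2 e3
    have z : ∀ r r' : ℕ, r + r' + 1 = N → sepWeight E r r' q u v = 0 := by
      refine fun r r' hr => if_neg ?_
      rintro ⟨a1, a2, a3, a4, a5⟩
      have c1 := hpos a1
      have c2 := hpos (hE.symm _ _ a2)
      have c3 := hpos a3
      have lu := ZMod.val_lt u
      have lv := ZMod.val_lt v
      omega
    rw [z s s' hN, z s' s (by omega), add_zero]

section Positions

variable {n : ℕ} {D U : Finset ℕ}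

/-- The number of elements of `S` that are smaller than `v`. -/
def below (S : Finset ℕ) (v : ℕ) : ℕ := (S.filter (fun d => d < v)).card

lemma below_mono (S : Finset ℕ) {a b : ℕ} (h : a ≤ b) : below S a ≤ below S b := by
  refine Finset.card_le_card fun d hd => ?_
  rw [Finset.mem_filter] at hd ⊢
  exact ⟨hd.1, by omega⟩

lemma below_strictMono {S : Finset ℕ} {a b : ℕ} (ha : a ∈ S) (h : a < b) :
    below S a < below S b := by
  refine Finset.card_lt_card ((Finset.ssubset_iff_of_subset fun d hd => ?_).2 ⟨a, ?_, ?_⟩)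
  · rw [Finset.mem_filter] at hd ⊢
    exact ⟨hd.1, by omega⟩
  · exact Finset.mem_filter.2 ⟨ha, h⟩
  · simp

lemma below_lt_card {S : Finset ℕ} {a : ℕ} (ha : a ∈ S) : below S a < S.card := by
  refine Finset.card_lt_card ((Finset.ssubset_iff_of_subset (Finset.filter_subset _ _)).2
    ⟨a, ha, ?_⟩)
  simp

lemma below_le_card (S : Finset ℕ) (a : ℕ) : below S a ≤ S.card := Finset.card_filter_le _ _

lemma card_above_add_below {S : Finset ℕ} {v : ℕ} (hv : v ∈ S) :
    (S.filter (fun u => v < u)).card + below S v + 1 = S.card := by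
  have h1 : below S v + (S.filter (fun d => ¬ d < v)).card = S.card :=
    Finset.card_filter_add_card_filter_not _
  have h2 : S.filter (fun d => ¬ d < v) = insert v (S.filter (fun u => v < u)) := by
    ext d
    simp only [Finset.mem_filter, Finset.mem_insert]
    constructor
    · rintro ⟨h, h'⟩
      rcases Nat.eq_or_lt_of_le (not_lt.1 h') with h3 | h3
      · exact Or.inl h3.symm
      · exact Or.inr ⟨h, h3⟩
    · rintro (rfl | ⟨h, h'⟩)
      · exact ⟨hv, lt_irrefl _⟩
      · exact ⟨h, by omega⟩
  rw [h2, Finset.card_insert_of_notMem (by simp)] at h1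
  omega

lemma card_add_card (hUD : D ∪ U = Finset.Icc 1 (n + 1)) (hdisj : Disjoint D U) :
    D.card + U.card = n + 1 := by
  rw [← Finset.card_union_of_disjoint hdisj, hUD, Nat.card_Icc]
  omega

lemma below_add_below (hUD : D ∪ U = Finset.Icc 1 (n + 1)) (hdisj : Disjoint D U) {v : ℕ}
    (h1 : 1 ≤ v) (h2 : v ≤ n + 2) : below D v + below U v + 1 = v := by
  have h : below D v + below U v = (Finset.Icc 1 (v - 1)).card := by
    rw [below, below, ← Finset.card_union_of_disjoint (Finset.disjoint_filter_filter hdisj),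
      ← Finset.filter_union, hUD]
    congr 1
    ext d
    simp only [Finset.mem_filter, Finset.mem_Icc]
    omega
  rw [Nat.card_Icc] at h
  omega

lemma mem_or_mem (hUD : D ∪ U = Finset.Icc 1 (n + 1)) {v : ℕ} (h1 : 1 ≤ v) (h2 : v ≤ n + 1) :
    v ∈ D ∨ v ∈ U := by
  rw [← Finset.mem_union, hUD, Finset.mem_Icc]
  exact ⟨h1, h2⟩

lemma mem_range_left (hUD : D ∪ U = Finset.Icc 1 (n + 1)) {v : ℕ} (h : v ∈ D) :
    1 ≤ v ∧ v ≤ n + 1 := by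
  rw [← Finset.mem_Icc, ← hUD]
  exact Finset.mem_union_left _ h

lemma mem_range_right (hUD : D ∪ U = Finset.Icc 1 (n + 1)) {v : ℕ} (h : v ∈ U) :
    1 ≤ v ∧ v ≤ n + 1 := by
  rw [← Finset.mem_Icc, ← hUD]
  exact Finset.mem_union_right _ h

lemma pos_cases (hUD : D ∪ U = Finset.Icc 1 (n + 1)) (hdisj : Disjoint D U) {v : ℕ}
    (hv : v ≤ n + 2) :
    (v = 0 ∧ v ∉ D ∧ v ∉ U ∧ pos n D U v = 0) ∨
    (v = n + 2 ∧ v ∉ D ∧ v ∉ U ∧ pos n D U v = D.card + 1) ∨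
    (1 ≤ v ∧ v ≤ n + 1 ∧ v ∈ D ∧ v ∉ U ∧ pos n D U v = 1 + below D v ∧
      below D v < D.card ∧ below U v ≤ U.card ∧ below D v + below U v + 1 = v) ∨
    (1 ≤ v ∧ v ≤ n + 1 ∧ v ∉ D ∧ v ∈ U ∧ pos n D U v + below U v = n + 2 ∧
      below U v < U.card ∧ below D v ≤ D.card ∧ below D v + below U v + 1 = v) := by
  have hc := card_add_card hUD hdisj
  rcases Nat.eq_zero_or_pos v with rfl | h0
  · refine Or.inl ⟨rfl, fun h => ?_, fun h => ?_, by simp [pos]⟩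
    · have := mem_range_left hUD h
      omega
    · have := mem_range_right hUD h
      omega
  rcases hv.eq_or_lt with rfl | h1
  · refine Or.inr (Or.inl ⟨rfl, fun h => ?_, fun h => ?_, by simp [pos]⟩)
    · have := mem_range_left hUD h
      omega
    · have := mem_range_right hUD h
      omega
  have hb := below_add_below hUD hdisj h0 hv
  by_cases hD : v ∈ D
  · have hU : v ∉ U := Finset.disjoint_left.1 hdisj hD
    refine Or.inr (Or.inr (Or.inl ⟨h0, by omega, hD, hU, ?_, below_lt_card hD,
      below_le_card _ _, hb⟩))
    rw [pos, if_neg (by omega), if_neg (by omega), if_pos hD, below]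
  · have hU := (mem_or_mem hUD h0 (by omega)).resolve_left hD
    refine Or.inr (Or.inr (Or.inr ⟨h0, by omega, hD, hU, ?_, below_lt_card hU,
      below_le_card _ _, hb⟩))
    have := card_above_add_below hU
    rw [pos, if_neg (by omega), if_neg (by omega), if_neg hD]
    omega

lemma pos_lt (hUD : D ∪ U = Finset.Icc 1 (n + 1)) (hdisj : Disjoint D U) {v : ℕ}
    (hv : v ≤ n + 2) : pos n D U v < n + 3 := by
  have hc := card_add_card hUD hdisj
  have h := pos_cases hUD hdisj hv
  omega

lemma pos_le (hUD : D ∪ U = Finset.Icc 1 (n + 1)) (hdisj : Disjoint D U) (v : ℕ) :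
    pos n D U v ≤ n + 3 := by
  rcases le_or_gt v (n + 2) with h | h
  · exact (pos_lt hUD hdisj h).le
  · have hc := card_add_card hUD hdisj
    have hD : v ∉ D := fun hm => by
      have := mem_range_left hUD hm
      omega
    have hU := Finset.card_filter_le U (fun u => v < u)
    rw [pos, if_neg (by omega), if_neg (by omega), if_neg hD]
    omega

lemma pos_injOn (hUD : D ∪ U = Finset.Icc 1 (n + 1)) (hdisj : Disjoint D U) {a b : ℕ}
    (ha : a ≤ n + 2) (hb : b ≤ n + 2) (h : pos n D U a = pos n D U b) : a = b := by
  wlog hab : a < b generalizing a b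
  · rcases (not_lt.1 hab).eq_or_lt with h1 | h1
    · exact h1.symm
    · exact (this hb ha h.symm h1).symm
  exfalso
  have hc := card_add_card hUD hdisj
  have sD := fun h : a ∈ D => below_strictMono h hab
  have sU := fun h : a ∈ U => below_strictMono h hab
  rcases pos_cases hUD hdisj ha with ha' | ha' | ha' | ha' <;>
  rcases pos_cases hUD hdisj hb with hb' | hb' | hb' | hb' <;>
  first
  | omega
  | (have := sD ha'.2.2.1; omega)
  | (have := sU ha'.2.2.2.1; omega)

/-- The position of a vertex on the cycle `ZMod (n + 3)`. -/
def cpos (n : ℕ) (D U : Finset ℕ) (v : ℕ) : ZMod (n + 3) := (pos n D U v : ZMod (n + 3))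

lemma val_cpos (hUD : D ∪ U = Finset.Icc 1 (n + 1)) (hdisj : Disjoint D U) {v : ℕ}
    (hv : v ≤ n + 2) : (cpos n D U v).val = pos n D U v := by
  rw [cpos, ZMod.val_natCast, Nat.mod_eq_of_lt (pos_lt hUD hdisj hv)]

lemma cpos_inj (hUD : D ∪ U = Finset.Icc 1 (n + 1)) (hdisj : Disjoint D U) {a b : ℕ}
    (ha : a ≤ n + 2) (hb : b ≤ n + 2) : cpos n D U a = cpos n D U b ↔ a = b := by
  refine ⟨fun h => pos_injOn hUD hdisj ha hb ?_, fun h => h ▸ rfl⟩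
  rw [← val_cpos hUD hdisj ha, ← val_cpos hUD hdisj hb, h]

lemma relpos_eq_cdist (hUD : D ∪ U = Finset.Icc 1 (n + 1)) (hdisj : Disjoint D U) (a v : ℕ) :
    relpos n D U a v = cdist (cpos n D U a) (cpos n D U v) := by
  have ha := pos_le hUD hdisj a
  have : cpos n D U v - cpos n D U a =
      ((pos n D U v + (n + 3) - pos n D U a : ℕ) : ZMod (n + 3)) := by
    rw [Nat.cast_sub (by omega), Nat.cast_add, ZMod.natCast_self, add_zero, cpos, cpos]
  rw [cdist, this, ZMod.val_natCast, relpos]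

lemma exists_pos_eq (hUD : D ∪ U = Finset.Icc 1 (n + 1)) (hdisj : Disjoint D U)
    (k : ZMod (n + 3)) : ∃ v : ℕ, v ≤ n + 2 ∧ pos n D U v = k.val := by
  let f : Fin (n + 3) → Fin (n + 3) := fun v => ⟨pos n D U v, pos_lt hUD hdisj (by omega)⟩
  have hf : Function.Injective f := fun a b h =>
    Fin.ext (pos_injOn hUD hdisj (by omega) (by omega) (congrArg Fin.val h))
  obtain ⟨v, hv⟩ := Finite.surjective_of_injective hf ⟨k.val, ZMod.val_lt k⟩
  exact ⟨v, by omega, congrArg Fin.val hv⟩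

lemma betaFn_spec (hUD : D ∪ U = Finset.Icc 1 (n + 1)) (hdisj : Disjoint D U)
    (k : ZMod (n + 3)) : betaFn n D U k ≤ n + 2 ∧ pos n D U (betaFn n D U k) = k.val := by
  have h := exists_pos_eq hUD hdisj k
  rw [betaFn, dif_pos h]
  exact h.choose_spec

lemma betaFn_le (hUD : D ∪ U = Finset.Icc 1 (n + 1)) (hdisj : Disjoint D U)
    (k : ZMod (n + 3)) : betaFn n D U k ≤ n + 2 := (betaFn_spec hUD hdisj k).1

lemma cpos_betaFn (hUD : D ∪ U = Finset.Icc 1 (n + 1)) (hdisj : Disjoint D U)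
    (k : ZMod (n + 3)) : cpos n D U (betaFn n D U k) = k := by
  rw [cpos, (betaFn_spec hUD hdisj k).2, ZMod.natCast_zmod_val]

lemma betaFn_cpos (hUD : D ∪ U = Finset.Icc 1 (n + 1)) (hdisj : Disjoint D U) {v : ℕ}
    (hv : v ≤ n + 2) : betaFn n D U (cpos n D U v) = v := by
  rw [← cpos_inj hUD hdisj (betaFn_le hUD hdisj _) hv, cpos_betaFn hUD hdisj]

lemma betaFn_inj (hUD : D ∪ U = Finset.Icc 1 (n + 1)) (hdisj : Disjoint D U)
    {x y : ZMod (n + 3)} : betaFn n D U x = betaFn n D U y ↔ x = y := by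
  refine ⟨fun h => ?_, fun h => h ▸ rfl⟩
  rw [← cpos_betaFn hUD hdisj x, h, cpos_betaFn hUD hdisj]

lemma cdist_cpos (hUD : D ∪ U = Finset.Icc 1 (n + 1)) (hdisj : Disjoint D U) {a b : ℕ}
    (ha : a ≤ n + 2) (hb : b ≤ n + 2) :
    (pos n D U a ≤ pos n D U b ∧
      cdist (cpos n D U a) (cpos n D U b) + pos n D U a = pos n D U b) ∨
    (pos n D U b < pos n D U a ∧
      cdist (cpos n D U a) (cpos n D U b) + pos n D U a = pos n D U b + (n + 3)) := by
  have h := cdist_rebase 0 (cpos n D U a) (cpos n D U b)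
  simpa only [cdist_zero_left, val_cpos hUD hdisj ha, val_cpos hUD hdisj hb] using h

lemma pos_cases_lt (hUD : D ∪ U = Finset.Icc 1 (n + 1)) (hdisj : Disjoint D U) {a b : ℕ}
    (hab : a < b) (hb : b ≤ n + 2) :
    below D a ≤ below D b ∧ below U a ≤ below U b ∧
    ((a = 0 ∧ a ∉ D ∧ a ∉ U ∧ pos n D U a = 0) ∨
    (1 ≤ a ∧ a ∈ D ∧ a ∉ U ∧ pos n D U a = 1 + below D a ∧
      below D a < D.card ∧ below U a ≤ U.card ∧ below D a + below U a + 1 = a ∧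
      below D a < below D b) ∨
    (1 ≤ a ∧ a ∉ D ∧ a ∈ U ∧ pos n D U a + below U a = n + 2 ∧
      below U a < U.card ∧ below D a ≤ D.card ∧ below D a + below U a + 1 = a ∧
      below U a < below U b)) := by
  refine ⟨below_mono D hab.le, below_mono U hab.le, ?_⟩
  rcases pos_cases hUD hdisj (hab.le.trans hb) with
    h | h | ⟨h1, h2, h3, h4, h5, h6, h7, h8⟩ | ⟨h1, h2, h3, h4, h5, h6, h7, h8⟩
  · exact Or.inl h
  · omega
  · exact Or.inr (Or.inl ⟨h1, h3, h4, h5, h6, h7, h8, below_strictMono h3 hab⟩)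
  · exact Or.inr (Or.inr ⟨h1, h3, h4, h5, h6, h7, h8, below_strictMono h4 hab⟩)

set_option maxHeartbeats 1000000 in
lemma cdist_le_of_lt (hUD : D ∪ U = Finset.Icc 1 (n + 1)) (hdisj : Disjoint D U)
    {a b : ℕ} (hab : a < b) (hb : b ≤ n + 2) :
    (a ∈ D → cdist (cpos n D U a) (cpos n D U b) ≤ n + 2 - a) ∧
    (b ∈ D → cdist (cpos n D U a) (cpos n D U b) ≤ b) ∧
    (a ∈ U → cdist (cpos n D U b) (cpos n D U a) ≤ n + 2 - a) ∧
    (b ∈ U → cdist (cpos n D U b) (cpos n D U a) ≤ b) := by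
  have hc := card_add_card hUD hdisj
  have ha : a ≤ n + 2 := by omega
  have d1 := cdist_cpos hUD hdisj ha hb
  have d2 := cdist_cpos hUD hdisj hb ha
  obtain ⟨mD, mU, h⟩ := pos_cases_lt hUD hdisj hab hb
  rcases h with ⟨a1, a2, a3, a4⟩ | ⟨a1, a2, a3, a4, a5, a6, a7, a8⟩ |
    ⟨a1, a2, a3, a4, a5, a6, a7, a8⟩ <;>
  rcases pos_cases hUD hdisj hb with ⟨b1, b2, b3, b4⟩ | ⟨b1, b2, b3, b4⟩ |
    ⟨b1, b2, b3, b4, b5, b6, b7, b8⟩ | ⟨b1, b2, b3, b4, b5, b6, b7, b8⟩ <;>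
  refine ⟨fun h => ?_, fun h => ?_, fun h => ?_, fun h => ?_⟩ <;>
  first
  | contradiction
  | omega

lemma card_between (hUD : D ∪ U = Finset.Icc 1 (n + 1)) (hdisj : Disjoint D U) (a b : ℕ) :
    ((Finset.range (n + 3)).filter (fun v => StrictBetween n D U a b v)).card =
      relpos n D U a b - 1 := by
  have hlt : relpos n D U a b < n + 3 := Nat.mod_lt _ (by omega)
  have : relpos n D U a b - 1 = (Finset.Ioo 0 (relpos n D U a b)).card := by
    rw [Nat.card_Ioo]
    omega
  rw [this]
  refine Finset.card_bij (fun v _ => relpos n D U a v) ?_ ?_ ?_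
  · intro v hv
    rw [Finset.mem_filter] at hv
    exact Finset.mem_Ioo.2 ⟨hv.2.2.1, hv.2.2.2⟩
  · intro v hv w hw h
    rw [Finset.mem_filter] at hv hw
    rwa [relpos_eq_cdist hUD hdisj, relpos_eq_cdist hUD hdisj, cdist_inj,
      cpos_inj hUD hdisj hv.2.1 hw.2.1] at h
  · intro m hm
    rw [Finset.mem_Ioo] at hm
    have hrel : relpos n D U a (betaFn n D U (cpos n D U a + (m : ZMod (n + 3)))) = m := by
      rw [relpos_eq_cdist hUD hdisj, cpos_betaFn hUD hdisj, cdist, add_sub_cancel_left,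
        ZMod.val_natCast, Nat.mod_eq_of_lt (by omega)]
    have hle := betaFn_le hUD hdisj (cpos n D U a + (m : ZMod (n + 3)))
    refine ⟨_, Finset.mem_filter.2 ⟨Finset.mem_range.2 (by omega), hle, ?_, ?_⟩, hrel⟩
    · rw [hrel]
      exact hm.1
    · rw [hrel]
      exact hm.2

lemma strictBetween_zero (hUD : D ∪ U = Finset.Icc 1 (n + 1)) (hdisj : Disjoint D U)
    {a b : ℕ} (hab : a < b) (hb : b ≤ n + 2) : StrictBetween n D U a b 0 ↔ a ∈ U := by
  have hc := card_add_card hUD hdisj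
  have ha : a ≤ n + 2 := by omega
  have d1 := cdist_cpos hUD hdisj ha hb
  have d2 := cdist_cpos hUD hdisj ha (Nat.zero_le _)
  have p0 : pos n D U 0 = 0 := by simp [pos]
  rw [StrictBetween, relpos_eq_cdist hUD hdisj, relpos_eq_cdist hUD hdisj]
  obtain ⟨mD, mU, h⟩ := pos_cases_lt hUD hdisj hab hb
  rcases h with ⟨a1, a2, a3, a4⟩ | ⟨a1, a2, a3, a4, a5, a6, a7, a8⟩ |
    ⟨a1, a2, a3, a4, a5, a6, a7, a8⟩ <;>
  rcases pos_cases hUD hdisj hb with ⟨b1, b2, b3, b4⟩ | ⟨b1, b2, b3, b4⟩ |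
    ⟨b1, b2, b3, b4, b5, b6, b7, b8⟩ | ⟨b1, b2, b3, b4, b5, b6, b7, b8⟩ <;>
  refine ⟨fun h => ?_, fun h => ?_⟩ <;>
  first
  | assumption
  | contradiction
  | omega

lemma strictBetween_last (hUD : D ∪ U = Finset.Icc 1 (n + 1)) (hdisj : Disjoint D U)
    {a b : ℕ} (hab : a < b) (hb : b ≤ n + 2) : StrictBetween n D U a b (n + 2) ↔ b ∈ U := by
  have hc := card_add_card hUD hdisj
  have ha : a ≤ n + 2 := by omega
  have d1 := cdist_cpos hUD hdisj ha hb
  have d2 := cdist_cpos hUD hdisj ha le_rfl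
  have p0 : pos n D U (n + 2) = D.card + 1 := by simp [pos]
  rw [StrictBetween, relpos_eq_cdist hUD hdisj, relpos_eq_cdist hUD hdisj]
  obtain ⟨mD, mU, h⟩ := pos_cases_lt hUD hdisj hab hb
  rcases h with ⟨a1, a2, a3, a4⟩ | ⟨a1, a2, a3, a4, a5, a6, a7, a8⟩ |
    ⟨a1, a2, a3, a4, a5, a6, a7, a8⟩ <;>
  rcases pos_cases hUD hdisj hb with ⟨b1, b2, b3, b4⟩ | ⟨b1, b2, b3, b4⟩ |
    ⟨b1, b2, b3, b4, b5, b6, b7, b8⟩ | ⟨b1, b2, b3, b4, b5, b6, b7, b8⟩ <;>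
  refine ⟨fun h => ?_, fun h => ?_⟩ <;>
  first
  | assumption
  | contradiction
  | omega

lemma bel_add_one (hUD : D ∪ U = Finset.Icc 1 (n + 1)) (hdisj : Disjoint D U)
    {a b : ℕ} (hab : a < b) (hb : b ≤ n + 2) :
    bel n D U (a, b) + 1 = cdist (cpos n D U a) (cpos n D U b) := by
  have hne : cpos n D U a ≠ cpos n D U b := fun h =>
    hab.ne ((cpos_inj hUD hdisj (by omega) hb).1 h)
  have hpos := mt cdist_eq_zero.1 hne
  have hcard := card_between hUD hdisj a b
  rw [relpos_eq_cdist hUD hdisj] at hcard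
  have hrange : Finset.range (n + 3) = insert 0 (insert (n + 2) (Finset.Icc 1 (n + 1))) := by
    ext v
    simp only [Finset.mem_range, Finset.mem_insert, Finset.mem_Icc]
    omega
  have hself : ∀ c, (c = a ∨ c = b) → ¬ StrictBetween n D U a b c := by
    rintro c (rfl | rfl) ⟨_, h1, h2⟩
    · rw [relpos_eq_cdist hUD hdisj, cdist_self] at h1
      exact lt_irrefl _ h1
    · exact lt_irrefl _ h2
  rw [Finset.card_filter, hrange, Finset.sum_insert (by simp), Finset.sum_insert (by simp),
    if_congr (strictBetween_zero hUD hdisj hab hb) rfl rfl,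
    if_congr (strictBetween_last hUD hdisj hab hb) rfl rfl] at hcard
  have hsplit : bel n D U (a, b) = ∑ v ∈ Finset.Icc 1 (n + 1),
      ((if StrictBetween n D U a b v then 1 else 0) +
        ((if v = a then (if a ∈ U then 1 else 0) else 0) +
         (if v = b then (if b ∈ U then 1 else 0) else 0))) := by
    rw [bel, Bel, Finset.card_filter]
    refine Finset.sum_congr rfl fun v _ => ?_
    simp only
    by_cases h1 : v = a
    · subst h1
      rw [if_neg (hself v (Or.inl rfl)), if_pos rfl, if_neg hab.ne]
      simp [hself v (Or.inl rfl)]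
    · by_cases h2 : v = b
      · subst h2
        rw [if_neg (hself v (Or.inr rfl)), if_neg h1, if_pos rfl]
        simp [hself v (Or.inr rfl)]
      · simp [h1, h2]
  have hU : ∀ c, (∑ v ∈ Finset.Icc 1 (n + 1), if v = c then (if c ∈ U then 1 else 0) else 0) =
      if c ∈ U then 1 else 0 := by
    intro c
    rw [Finset.sum_ite_eq' _ c (fun _ => if c ∈ U then 1 else 0)]
    by_cases hc : c ∈ U
    · rw [if_pos (Finset.mem_Icc.2 (mem_range_right hUD hc))]
    · simp [hc]
  rw [hsplit, Finset.sum_add_distrib, Finset.sum_add_distrib, hU, hU]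
  omega

end Positions

/-- `φ` is a rotation or a reflection of the cycle `ZMod N`, with inverse `ψ`. -/
structure IsDihedral {N : ℕ} (φ ψ : ZMod N → ZMod N) : Prop where
  left_inv : ∀ x, ψ (φ x) = x
  right_inv : ∀ x, φ (ψ x) = x
  dist : (∀ x y, cdist (φ x) (φ y) = cdist x y) ∨ (∀ x y, cdist (φ x) (φ y) = cdist y x)

namespace IsDihedral

variable {N : ℕ} {φ ψ : ZMod N → ZMod N}

lemma symm (h : IsDihedral φ ψ) : IsDihedral ψ φ where
  left_inv := h.right_inv
  right_inv := h.left_inv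
  dist := by
    rcases h.dist with hd | hd
    · exact Or.inl fun x y => by rw [← hd, h.right_inv, h.right_inv]
    · exact Or.inr fun x y => by rw [← hd, h.right_inv, h.right_inv]

lemma injective (h : IsDihedral φ ψ) {x y : ZMod N} : φ x = φ y ↔ x = y :=
  ⟨fun e => by rw [← h.left_inv x, e, h.left_inv], fun e => e ▸ rfl⟩

lemma dist_one (h : IsDihedral φ ψ) (x y : ZMod N) :
    (cdist (φ x) (φ y) = 1 ∨ cdist (φ y) (φ x) = 1) ↔ (cdist x y = 1 ∨ cdist y x = 1) := by
  rcases h.dist with hd | hd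
  · rw [hd, hd]
  · rw [hd, hd, or_comm]

/-- The underlying permutation. -/
def toEquiv (h : IsDihedral φ ψ) : ZMod N ≃ ZMod N := ⟨φ, ψ, h.left_inv, h.right_inv⟩

end IsDihedral

lemma isDihedral_add {N : ℕ} (k : ZMod N) : IsDihedral (fun x => x + k) (fun x => x - k) where
  left_inv x := by ring
  right_inv x := by ring
  dist := Or.inl fun x y => by simp only [cdist]; congr 1; ring

lemma isDihedral_sub {N : ℕ} (k : ZMod N) : IsDihedral (fun x => k - x) (fun x => k - x) where
  left_inv x := by ring
  right_inv x := by ring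
  dist := Or.inr fun x y => by simp only [cdist]; congr 1; ring

/-- `c` lies strictly inside the counterclockwise arc from `a` to `b`. -/
def CBetween {N : ℕ} (a b c : ZMod N) : Prop := 0 < cdist a c ∧ cdist a c < cdist a b

/-- The chords `ab` and `cd` cross. -/
def CCross {N : ℕ} (a b c d : ZMod N) : Prop :=
  (CBetween a b c ∧ CBetween b a d) ∨ (CBetween a b d ∧ CBetween b a c)

lemma CCross.swap_left {N : ℕ} {a b c d : ZMod N} : CCross b a c d ↔ CCross a b c d := by
  unfold CCross
  tauto

lemma CCross.swap_right {N : ℕ} {a b c d : ZMod N} : CCross a b d c ↔ CCross a b c d := by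
  unfold CCross
  tauto

lemma cBetween_reverse {N : ℕ} [NeZero N] (a b c : ZMod N) :
    (0 < cdist c a ∧ cdist c a < cdist b a) ↔ CBetween b a c := by
  have h1 := cdist_rebase a b c
  have h2 := cdist_rebase a b a
  have h3 := cdist_rebase a c a
  have h4 := cdist_self a
  have h5 := cdist_lt a b
  have h6 := cdist_lt a c
  unfold CBetween
  omega

lemma not_cBetween_of_cBetween {N : ℕ} [NeZero N] {a b c : ZMod N} (h : CBetween a b c) :
    ¬ CBetween b a c := by
  have h1 := cdist_rebase a b c
  have h2 := cdist_rebase a b a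
  have h4 := cdist_self a
  have h6 := cdist_lt a c
  unfold CBetween at *
  omega

lemma IsDihedral.cCross {N : ℕ} [NeZero N] {φ ψ : ZMod N → ZMod N} (h : IsDihedral φ ψ)
    (a b c d : ZMod N) : CCross (φ a) (φ b) (φ c) (φ d) ↔ CCross a b c d := by
  rcases h.dist with hd | hd
  · simp only [CCross, CBetween, hd]
  · have hr : ∀ a b c, CBetween (φ a) (φ b) (φ c) ↔ CBetween b a c := by
      intro a b c
      rw [← cBetween_reverse, CBetween, hd, hd]
    simp only [CCross, hr]
    tauto

section Diagonals

variable {n : ℕ} {D U : Finset ℕ}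

lemma strictBetween_iff (hUD : D ∪ U = Finset.Icc 1 (n + 1)) (hdisj : Disjoint D U)
    {a b v : ℕ} : StrictBetween n D U a b v ↔
      v ≤ n + 2 ∧ CBetween (cpos n D U a) (cpos n D U b) (cpos n D U v) := by
  rw [StrictBetween, relpos_eq_cdist hUD hdisj, relpos_eq_cdist hUD hdisj, CBetween]

lemma CCross.ne {N : ℕ} [NeZero N] {a b c d : ZMod N} (h : CCross a b c d) :
    a ≠ b ∧ c ≠ d ∧ a ≠ c ∧ a ≠ d ∧ b ≠ c ∧ b ≠ d := by
  have key : ∀ a b c : ZMod N, CBetween a b c → a ≠ b ∧ a ≠ c ∧ c ≠ b := by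
    rintro a b c ⟨h1, h2⟩
    refine ⟨?_, ?_, ?_⟩
    · rintro rfl
      rw [cdist_self] at h2
      omega
    · rintro rfl
      rw [cdist_self] at h1
      omega
    · rintro rfl
      omega
  rcases h with ⟨h1, h2⟩ | ⟨h1, h2⟩
  · have k1 := key _ _ _ h1
    have k2 := key _ _ _ h2
    exact ⟨k1.1, fun e => not_cBetween_of_cBetween h1 (e ▸ h2), k1.2.1, k2.2.2.symm,
      k1.2.2.symm, k2.2.1⟩
  · have k1 := key _ _ _ h1
    have k2 := key _ _ _ h2
    exact ⟨k1.1, fun e => not_cBetween_of_cBetween h1 (e ▸ h2), k2.2.2.symm, k1.2.1,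
      k2.2.1, k1.2.2.symm⟩

lemma cross_iff (hUD : D ∪ U = Finset.Icc 1 (n + 1)) (hdisj : Disjoint D U) {δ δ' : ℕ × ℕ} :
    Cross n D U δ δ' ↔ δ'.1 ≤ n + 2 ∧ δ'.2 ≤ n + 2 ∧
      CCross (cpos n D U δ.1) (cpos n D U δ.2) (cpos n D U δ'.1) (cpos n D U δ'.2) := by
  simp only [Cross, strictBetween_iff hUD hdisj]
  constructor
  · rintro ⟨-, -, -, -, -, -, ⟨⟨h1, h2⟩, h3, h4⟩ | ⟨⟨h1, h2⟩, h3, h4⟩⟩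
    · exact ⟨h1, h3, Or.inl ⟨h2, h4⟩⟩
    · exact ⟨h3, h1, Or.inr ⟨h2, h4⟩⟩
  · rintro ⟨h1, h2, h⟩
    obtain ⟨n1, n2, n3, n4, n5, n6⟩ := h.ne
    refine ⟨mt (congrArg _) n1, mt (congrArg _) n2, mt (congrArg _) n3, mt (congrArg _) n4,
      mt (congrArg _) n5, mt (congrArg _) n6, ?_⟩
    rcases h with h | h
    · exact Or.inl ⟨⟨h1, h.1⟩, h2, h.2⟩
    · exact Or.inr ⟨⟨h2, h.1⟩, h1, h.2⟩

/-- The diagonal joining the vertices at positions `x` and `y`. -/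
def diagOf (n : ℕ) (D U : Finset ℕ) (x y : ZMod (n + 3)) : ℕ × ℕ :=
  (min (betaFn n D U x) (betaFn n D U y), max (betaFn n D U x) (betaFn n D U y))

/-- The vertex map induced by a map of positions. -/
def posMap (n : ℕ) (D U : Finset ℕ) (φ : ZMod (n + 3) → ZMod (n + 3)) (v : ℕ) : ℕ :=
  betaFn n D U (φ (cpos n D U v))

lemma mapDiag_posMap (φ : ZMod (n + 3) → ZMod (n + 3)) (δ : ℕ × ℕ) :
    mapDiag (posMap n D U φ) δ = diagOf n D U (φ (cpos n D U δ.1)) (φ (cpos n D U δ.2)) := rfl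

lemma diagOf_comm (x y : ZMod (n + 3)) : diagOf n D U x y = diagOf n D U y x := by
  rw [diagOf, diagOf, min_comm, max_comm]

lemma diagOf_eq (x y : ZMod (n + 3)) :
    diagOf n D U x y = (betaFn n D U x, betaFn n D U y) ∨
      diagOf n D U x y = (betaFn n D U y, betaFn n D U x) := by
  rcases le_total (betaFn n D U x) (betaFn n D U y) with h | h
  · exact Or.inl (by rw [diagOf, min_eq_left h, max_eq_right h])
  · exact Or.inr (by rw [diagOf, min_eq_right h, max_eq_left h])

lemma diagOf_cpos (hUD : D ∪ U = Finset.Icc 1 (n + 1)) (hdisj : Disjoint D U) {a b : ℕ}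
    (hab : a < b) (hb : b ≤ n + 2) : diagOf n D U (cpos n D U a) (cpos n D U b) = (a, b) := by
  rw [diagOf, betaFn_cpos hUD hdisj hb, betaFn_cpos hUD hdisj (by omega), min_eq_left hab.le,
    max_eq_right hab.le]

lemma mapDiag_diagOf (hUD : D ∪ U = Finset.Icc 1 (n + 1)) (hdisj : Disjoint D U)
    (φ : ZMod (n + 3) → ZMod (n + 3)) (x y : ZMod (n + 3)) :
    mapDiag (posMap n D U φ) (diagOf n D U x y) = diagOf n D U (φ x) (φ y) := by
  rw [mapDiag_posMap]
  rcases diagOf_eq (D := D) (U := U) x y with h | h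
  · rw [h]
    simp only [cpos_betaFn hUD hdisj]
  · rw [h]
    simp only [cpos_betaFn hUD hdisj]
    exact diagOf_comm _ _

lemma isBoundaryEdge_iff (hUD : D ∪ U = Finset.Icc 1 (n + 1)) (hdisj : Disjoint D U)
    {a b : ℕ} (hab : a < b) (hb : b ≤ n + 2) : IsBoundaryEdge n D U (a, b) ↔
      (cdist (cpos n D U a) (cpos n D U b) = 1 ∨ cdist (cpos n D U b) (cpos n D U a) = 1) := by
  rw [IsBoundaryEdge, relpos_eq_cdist hUD hdisj, relpos_eq_cdist hUD hdisj]
  exact and_iff_right ⟨hab, hb⟩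

lemma isInternalDiag_diagOf (hUD : D ∪ U = Finset.Icc 1 (n + 1)) (hdisj : Disjoint D U)
    {x y : ZMod (n + 3)} : IsInternalDiag n D U (diagOf n D U x y) ↔
      x ≠ y ∧ ¬ (cdist x y = 1 ∨ cdist y x = 1) := by
  wlog h : betaFn n D U x ≤ betaFn n D U y generalizing x y
  · rw [diagOf_comm, this (not_le.1 h).le, ne_comm, or_comm]
  rw [diagOf, min_eq_left h, max_eq_right h]
  rcases h.lt_or_eq with h | h
  · have hne : x ≠ y := fun e => by rw [e] at h; exact lt_irrefl _ h
    rw [IsInternalDiag, isBoundaryEdge_iff hUD hdisj h (betaFn_le hUD hdisj _),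
      cpos_betaFn hUD hdisj, cpos_betaFn hUD hdisj]
    exact and_congr_left fun _ =>
      iff_of_true ⟨h, betaFn_le hUD hdisj _⟩ hne
  · exact iff_of_false (fun e => e.1.1.ne h) fun e => e.1 ((betaFn_inj hUD hdisj).1 h)

lemma cross_diagOf (hUD : D ∪ U = Finset.Icc 1 (n + 1)) (hdisj : Disjoint D U)
    {x y z w : ZMod (n + 3)} :
    Cross n D U (diagOf n D U x y) (diagOf n D U z w) ↔ CCross x y z w := by
  rw [cross_iff hUD hdisj]
  have hle := betaFn_le hUD hdisj
  rcases diagOf_eq (D := D) (U := U) x y with h | h <;>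
  rcases diagOf_eq (D := D) (U := U) z w with h' | h' <;>
  simp only [h, h', cpos_betaFn hUD hdisj, hle, true_and, CCross.swap_left (a := x) (b := y),
    CCross.swap_right (c := z) (d := w)]

lemma IsDihedral.isInternalDiag (hUD : D ∪ U = Finset.Icc 1 (n + 1)) (hdisj : Disjoint D U)
    {φ ψ : ZMod (n + 3) → ZMod (n + 3)} (h : IsDihedral φ ψ) {δ : ℕ × ℕ}
    (hδ : IsInternalDiag n D U δ) : IsInternalDiag n D U (mapDiag (posMap n D U φ) δ) := by
  have hδ' : IsInternalDiag n D U (diagOf n D U (cpos n D U δ.1) (cpos n D U δ.2)) := by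
    rw [diagOf_cpos hUD hdisj hδ.1.1 hδ.1.2]
    exact hδ
  rw [mapDiag_posMap, isInternalDiag_diagOf hUD hdisj, h.dist_one, Ne, h.injective]
  exact (isInternalDiag_diagOf hUD hdisj).1 hδ'

lemma IsDihedral.cross (hUD : D ∪ U = Finset.Icc 1 (n + 1)) (hdisj : Disjoint D U)
    {φ ψ : ZMod (n + 3) → ZMod (n + 3)} (h : IsDihedral φ ψ) {δ δ' : ℕ × ℕ}
    (hc : Cross n D U δ δ') :
    Cross n D U (mapDiag (posMap n D U φ) δ) (mapDiag (posMap n D U φ) δ') := by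
  rw [mapDiag_posMap, mapDiag_posMap, cross_diagOf hUD hdisj, h.cCross]
  exact ((cross_iff hUD hdisj).1 hc).2.2

lemma IsDihedral.mapDiag_mapDiag (hUD : D ∪ U = Finset.Icc 1 (n + 1)) (hdisj : Disjoint D U)
    {φ ψ : ZMod (n + 3) → ZMod (n + 3)} (h : IsDihedral φ ψ) {δ : ℕ × ℕ}
    (hδ : IsInternalDiag n D U δ) :
    mapDiag (posMap n D U ψ) (mapDiag (posMap n D U φ) δ) = δ := by
  rw [mapDiag_posMap φ, mapDiag_diagOf hUD hdisj, h.left_inv, h.left_inv,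
    diagOf_cpos hUD hdisj hδ.1.1 hδ.1.2]

lemma IsDihedral.isTriangulation (hUD : D ∪ U = Finset.Icc 1 (n + 1)) (hdisj : Disjoint D U)
    {φ ψ : ZMod (n + 3) → ZMod (n + 3)} (h : IsDihedral φ ψ) {T : Finset (ℕ × ℕ)}
    (hT : IsTriangulation n D U T) :
    IsTriangulation n D U (T.image (mapDiag (posMap n D U φ))) := by
  obtain ⟨h1, h2, h3⟩ := hT
  refine ⟨?_, ?_, ?_⟩
  · intro δ hδ
    obtain ⟨ε, hε, rfl⟩ := Finset.mem_image.1 hδ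
    exact h.isInternalDiag hUD hdisj (h1 ε hε)
  · intro δ hδ δ' hδ' hc
    obtain ⟨ε, hε, rfl⟩ := Finset.mem_image.1 hδ
    obtain ⟨ε', hε', rfl⟩ := Finset.mem_image.1 hδ'
    have := h.symm.cross hUD hdisj hc
    rw [h.mapDiag_mapDiag hUD hdisj (h1 ε hε), h.mapDiag_mapDiag hUD hdisj (h1 ε' hε')] at this
    exact h2 ε hε ε' hε' this
  · intro δ hδ hnot
    have hback := h.symm.mapDiag_mapDiag hUD hdisj hδ
    obtain ⟨δ', hδ', hc⟩ := h3 _ (h.symm.isInternalDiag hUD hdisj hδ)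
      fun hm => hnot (Finset.mem_image.2 ⟨_, hm, hback⟩)
    refine ⟨_, Finset.mem_image_of_mem _ hδ', ?_⟩
    have := h.cross hUD hdisj hc
    rwa [hback] at this

/-- The edges of a triangulation (including boundary edges) in terms of positions. -/
def edgeRel (n : ℕ) (D U : Finset ℕ) (T : Finset (ℕ × ℕ)) (x y : ZMod (n + 3)) : Prop :=
  x ≠ y ∧ (diagOf n D U x y ∈ T ∨ cdist x y = 1 ∨ cdist y x = 1)

lemma edgeRel_symm {T : Finset (ℕ × ℕ)} {x y : ZMod (n + 3)} (h : edgeRel n D U T x y) :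
    edgeRel n D U T y x :=
  ⟨h.1.symm, by rw [diagOf_comm]; exact h.2.imp_right Or.symm⟩

lemma edgeOf_iff (hUD : D ∪ U = Finset.Icc 1 (n + 1)) (hdisj : Disjoint D U)
    {T : Finset (ℕ × ℕ)} {a b : ℕ} (hab : a < b) (hb : b ≤ n + 2) :
    EdgeOf n D U T a b ↔ edgeRel n D U T (cpos n D U a) (cpos n D U b) := by
  rw [EdgeOf, isBoundaryEdge_iff hUD hdisj hab hb, edgeRel, diagOf_cpos hUD hdisj hab hb, Ne,
    cpos_inj hUD hdisj (by omega) hb]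
  exact (and_iff_right hab.ne).symm

lemma edgeRel_image (hUD : D ∪ U = Finset.Icc 1 (n + 1)) (hdisj : Disjoint D U)
    {φ ψ : ZMod (n + 3) → ZMod (n + 3)} (h : IsDihedral φ ψ) {T : Finset (ℕ × ℕ)}
    (hT : IsTriangulation n D U T) (x y : ZMod (n + 3)) :
    edgeRel n D U (T.image (mapDiag (posMap n D U φ))) (φ x) (φ y) ↔ edgeRel n D U T x y := by
  rw [edgeRel, edgeRel, h.dist_one, Ne, h.injective]
  refine and_congr_right fun _ => or_congr_left ⟨fun hm => ?_, fun hm => ?_⟩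
  · obtain ⟨δ, hδ, he⟩ := Finset.mem_image.1 hm
    have := congrArg (mapDiag (posMap n D U ψ)) he
    rw [h.mapDiag_mapDiag hUD hdisj (hT.1 δ hδ), mapDiag_diagOf hUD hdisj, h.left_inv,
      h.left_inv] at this
    exact this ▸ hδ
  · exact Finset.mem_image.2 ⟨_, hm, mapDiag_diagOf hUD hdisj φ x y⟩

lemma IsTriangulation.cyclicTriangulation (hUD : D ∪ U = Finset.Icc 1 (n + 1))
    (hdisj : Disjoint D U) {T : Finset (ℕ × ℕ)} (hT : IsTriangulation n D U T) :
    CyclicTriangulation (n + 3) (edgeRel n D U T) where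
  symm _ _ h := edgeRel_symm h
  ne _ _ h := h.1
  adj a := by
    have h1 := cdist_add_one (N := n + 3) (by omega) a
    refine ⟨fun h => ?_, Or.inr (Or.inl h1)⟩
    have := cdist_eq_zero.2 h
    omega
  noncross a b c d hac hbd h1 h2 h3 := by
    have e1 := cdist_rebase a b d
    have e2 := cdist_rebase a c d
    have e3 := cdist_rebase a c a
    have e4 := cdist_rebase a d b
    have e5 := cdist_self a
    have e6 := cdist_lt a d
    refine hT.2.1 _ (hac.2.resolve_right (by omega)) _ (hbd.2.resolve_right (by omega)) ?_
    rw [cross_diagOf hUD hdisj]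
    exact Or.inl ⟨⟨h1, h2⟩, by omega, by omega⟩
  maximal a b hab hE := by
    obtain ⟨⟨u, v⟩, hδ, hc⟩ := hT.2.2 (diagOf n D U a b)
      ((isInternalDiag_diagOf hUD hdisj).2 ⟨hab, fun h => hE ⟨hab, Or.inr h⟩⟩)
      fun h => hE ⟨hab, Or.inl h⟩
    have hi := (hT.1 _ hδ).1
    have hd := diagOf_cpos hUD hdisj hi.1 hi.2
    rw [← hd, cross_diagOf hUD hdisj] at hc
    have hedge : edgeRel n D U T (cpos n D U u) (cpos n D U v) :=
      ⟨hc.ne.2.1, Or.inl (by rw [hd]; exact hδ)⟩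
    have key : ∀ y, CBetween b a y → cdist a b < cdist a y := by
      rintro y ⟨h1, h2⟩
      have e1 := cdist_rebase a b y
      have e2 := cdist_rebase a b a
      have e3 := cdist_self a
      have e4 := cdist_lt a y
      omega
    rcases hc with ⟨h1, h2⟩ | ⟨h1, h2⟩
    · exact ⟨_, _, hedge, h1.1, h1.2, key _ h2⟩
    · exact ⟨_, _, edgeRel_symm hedge, h1.1, h1.2, key _ h2⟩

lemma isTriangleOf_iff (hUD : D ∪ U = Finset.Icc 1 (n + 1)) (hdisj : Disjoint D U)
    {T : Finset (ℕ × ℕ)} {i j k : ℕ} : IsTriangleOf n D U T i j k ↔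
      i < j ∧ j < k ∧ k ≤ n + 2 ∧ edgeRel n D U T (cpos n D U i) (cpos n D U j) ∧
        edgeRel n D U T (cpos n D U j) (cpos n D U k) ∧
        edgeRel n D U T (cpos n D U i) (cpos n D U k) := by
  constructor
  · rintro ⟨h1, h2, h3, e1, e2, e3⟩
    exact ⟨h1, h2, h3, (edgeOf_iff hUD hdisj h1 (by omega)).1 e1,
      (edgeOf_iff hUD hdisj h2 h3).1 e2, (edgeOf_iff hUD hdisj (by omega) h3).1 e3⟩
  · rintro ⟨h1, h2, h3, e1, e2, e3⟩
    exact ⟨h1, h2, h3, (edgeOf_iff hUD hdisj h1 (by omega)).2 e1,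
      (edgeOf_iff hUD hdisj h2 h3).2 e2, (edgeOf_iff hUD hdisj (by omega) h3).2 e3⟩

lemma xcoord_of_mem_D (hUD : D ∪ U = Finset.Icc 1 (n + 1)) (hdisj : Disjoint D U)
    {T : Finset (ℕ × ℕ)} (hT : IsTriangulation n D U T) {j : ℕ} (hj : j ∈ D) :
    xcoord n D U T j =
      ∑ u, ∑ v, sepWeight (edgeRel n D U T) (n + 2 - j) j (cpos n D U j) u v := by
  have hE := hT.cyclicTriangulation hUD hdisj
  have hj' := mem_range_left hUD hj
  have hs : n + 2 - j + j + 1 = n + 3 := by omega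
  have hex : ∃ p : ℕ × ℕ, IsTriangleOf n D U T p.1 j p.2 := by
    obtain ⟨u, v, hu, hv, huv, hus, hvs⟩ := hE.exists_separating (by omega) hj'.1 hs (cpos n D U j)
    have hu' := cdist_add_cdist hu.1
    have hv' := cdist_add_cdist hv.1
    rw [← cpos_betaFn hUD hdisj u] at hu hus huv hu'
    rw [← cpos_betaFn hUD hdisj v] at hv hvs huv hv'
    have hbu := betaFn_le hUD hdisj u
    have hbv := betaFn_le hUD hdisj v
    refine ⟨(betaFn n D U v, betaFn n D U u), (isTriangleOf_iff hUD hdisj).2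
      ⟨?_, ?_, hbu, edgeRel_symm hv, hu, edgeRel_symm huv⟩⟩
    · by_contra hlt
      have hne : betaFn n D U v ≠ j := fun h => hv.1 (by rw [h])
      have := (cdist_le_of_lt hUD hdisj (show j < betaFn n D U v by omega) hbv).1 hj
      omega
    · by_contra hlt
      have hne : betaFn n D U u ≠ j := fun h => hu.1 (by rw [h])
      have := (cdist_le_of_lt hUD hdisj (show betaFn n D U u < j by omega) (by omega)).2.1 hj
      simp only at hlt
      omega
  rw [xcoord, dif_pos hex, if_pos hj]
  obtain ⟨h1, h2, h3, e1, e2, e3⟩ := (isTriangleOf_iff hUD hdisj).1 hex.choose_spec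
  rw [hE.sum_sepWeight hs e2 (edgeRel_symm e1) (edgeRel_symm e3)
    ((cdist_le_of_lt hUD hdisj h2 h3).1 hj) ((cdist_le_of_lt hUD hdisj h1 (by omega)).2.1 hj),
    ← bel_add_one hUD hdisj h1 (by omega), ← bel_add_one hUD hdisj h2 h3]
  push_cast
  ring

lemma xcoord_of_mem_U (hUD : D ∪ U = Finset.Icc 1 (n + 1)) (hdisj : Disjoint D U)
    {T : Finset (ℕ × ℕ)} (hT : IsTriangulation n D U T) {j : ℕ} (hj : j ∈ U) :
    xcoord n D U T j = (n : ℝ) + 2 -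
      ∑ u, ∑ v, sepWeight (edgeRel n D U T) j (n + 2 - j) (cpos n D U j) u v := by
  have hE := hT.cyclicTriangulation hUD hdisj
  have hj' := mem_range_right hUD hj
  have hs : j + (n + 2 - j) + 1 = n + 3 := by omega
  have hex : ∃ p : ℕ × ℕ, IsTriangleOf n D U T p.1 j p.2 := by
    obtain ⟨u, v, hu, hv, huv, hus, hvs⟩ := hE.exists_separating hj'.1 (by omega) hs (cpos n D U j)
    have hu' := cdist_add_cdist hu.1
    have hv' := cdist_add_cdist hv.1
    rw [← cpos_betaFn hUD hdisj u] at hu hus huv hu'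
    rw [← cpos_betaFn hUD hdisj v] at hv hvs huv hv'
    have hbu := betaFn_le hUD hdisj u
    have hbv := betaFn_le hUD hdisj v
    refine ⟨(betaFn n D U u, betaFn n D U v), (isTriangleOf_iff hUD hdisj).2
      ⟨?_, ?_, hbv, edgeRel_symm hu, hv, huv⟩⟩
    · by_contra hlt
      have hne : betaFn n D U u ≠ j := fun h => hu.1 (by rw [h])
      have := (cdist_le_of_lt hUD hdisj (show j < betaFn n D U u by omega) hbu).2.2.1 hj
      omega
    · by_contra hlt
      have hne : betaFn n D U v ≠ j := fun h => hv.1 (by rw [h])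
      have := (cdist_le_of_lt hUD hdisj (show betaFn n D U v < j by omega) (by omega)).2.2.2 hj
      simp only at hlt
      omega
  rw [xcoord, dif_pos hex, if_neg (Finset.disjoint_right.1 hdisj hj)]
  obtain ⟨h1, h2, h3, e1, e2, e3⟩ := (isTriangleOf_iff hUD hdisj).1 hex.choose_spec
  rw [hE.sum_sepWeight hs (edgeRel_symm e1) e2 e3
    ((cdist_le_of_lt hUD hdisj h1 (by omega)).2.2.2 hj)
    ((cdist_le_of_lt hUD hdisj h2 h3).2.2.1 hj)]
  have b1 := bel_add_one hUD hdisj h1 (by omega)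
  have b2 := bel_add_one hUD hdisj h2 h3
  have c1 := cdist_add_cdist e1.1
  have c2 := cdist_add_cdist e2.1
  have r1 : (cdist (cpos n D U j) (cpos n D U hex.choose.1) : ℝ) =
      n + 2 - bel n D U (hex.choose.1, j) := by
    rw [eq_sub_iff_add_eq]
    exact_mod_cast (by omega : cdist (cpos n D U j) (cpos n D U hex.choose.1) +
      bel n D U (hex.choose.1, j) = n + 2)
  have r2 : (cdist (cpos n D U hex.choose.2) (cpos n D U j) : ℝ) =
      n + 2 - bel n D U (j, hex.choose.2) := by
    rw [eq_sub_iff_add_eq]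
    exact_mod_cast (by omega : cdist (cpos n D U hex.choose.2) (cpos n D U j) +
      bel n D U (j, hex.choose.2) = n + 2)
  rw [r1, r2]

end Diagonals

lemma sum_sepWeight_of_preserving {N : ℕ} [NeZero N] {φ ψ : ZMod N → ZMod N}
    (h : IsDihedral φ ψ) (hd : ∀ x y, cdist (φ x) (φ y) = cdist x y)
    {E E' : ZMod N → ZMod N → Prop} (hE : ∀ x y, E' (φ x) (φ y) ↔ E x y) (s s' : ℕ)
    (q : ZMod N) :
    ∑ u, ∑ v, sepWeight E' s s' q u v = ∑ u, ∑ v, sepWeight E s s' (ψ q) u v := by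
  rw [← h.toEquiv.sum_comp]
  refine Finset.sum_congr rfl fun u _ => ?_
  rw [← h.toEquiv.sum_comp]
  refine Finset.sum_congr rfl fun v _ => ?_
  obtain ⟨q, rfl⟩ : ∃ q', φ q' = q := ⟨ψ q, h.right_inv q⟩
  rw [h.left_inv]
  change sepWeight E' s s' (φ q) (φ u) (φ v) = _
  simp only [sepWeight, hd, hE]

lemma sum_sepWeight_of_reversing {N : ℕ} [NeZero N] {φ ψ : ZMod N → ZMod N}
    (h : IsDihedral φ ψ) (hd : ∀ x y, cdist (φ x) (φ y) = cdist y x)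
    {E E' : ZMod N → ZMod N → Prop} (hE : ∀ x y, E' (φ x) (φ y) ↔ E x y)
    (hsymm : ∀ x y, E x y → E y x) (s s' : ℕ) (q : ZMod N) :
    ∑ u, ∑ v, sepWeight E' s s' q u v = ∑ u, ∑ v, sepWeight E s' s (ψ q) u v := by
  rw [Finset.sum_comm, ← h.toEquiv.sum_comp]
  refine Finset.sum_congr rfl fun v _ => ?_
  rw [← h.toEquiv.sum_comp]
  refine Finset.sum_congr rfl fun u _ => ?_
  obtain ⟨q, rfl⟩ : ∃ q', φ q' = q := ⟨ψ q, h.right_inv q⟩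
  rw [h.left_inv]
  change sepWeight E' s s' (φ q) (φ u) (φ v) = _
  have huv : E u v ↔ E v u := ⟨hsymm _ _, hsymm _ _⟩
  simp only [sepWeight, hd, hE, huv]
  refine if_congr (by tauto) (mul_comm _ _) rfl

lemma sum_dihedral_sepWeight {n : ℕ} {D U : Finset ℕ} (hUD : D ∪ U = Finset.Icc 1 (n + 1))
    (hdisj : Disjoint D U) {T : Finset (ℕ × ℕ)} (hT : IsTriangulation n D U T) {s s' : ℕ}
    (hs : 1 ≤ s) (hs' : 1 ≤ s') (hN : s + s' + 1 = n + 3) (q : ZMod (n + 3)) :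
    ∑ k : ZMod (n + 3),
      (∑ u, ∑ v, sepWeight (edgeRel n D U (T.image (mapDiag (rotMap n D U k)))) s s' q u v +
       ∑ u, ∑ v, sepWeight (edgeRel n D U (T.image (mapDiag (reflMap n D U k)))) s s' q u v) =
      ((n : ℝ) + 2) * (n + 3) := by
  have hrot : ∀ k : ZMod (n + 3),
      ∑ u, ∑ v, sepWeight (edgeRel n D U (T.image (mapDiag (rotMap n D U k)))) s s' q u v =
      ∑ u, ∑ v, sepWeight (edgeRel n D U T) s s' (q - k) u v := fun k =>
    sum_sepWeight_of_preserving (isDihedral_add k)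
      (fun x y => by simp only [cdist]; congr 1; ring)
      (edgeRel_image hUD hdisj (isDihedral_add k) hT) s s' q
  have hrefl : ∀ k : ZMod (n + 3),
      ∑ u, ∑ v, sepWeight (edgeRel n D U (T.image (mapDiag (reflMap n D U k)))) s s' q u v =
      ∑ u, ∑ v, sepWeight (edgeRel n D U T) s' s (k - q) u v := fun k =>
    sum_sepWeight_of_reversing (isDihedral_sub k)
      (fun x y => by simp only [cdist]; congr 1; ring)
      (edgeRel_image hUD hdisj (isDihedral_sub k) hT) (fun _ _ => edgeRel_symm) s s' q
  have htot := (hT.cyclicTriangulation hUD hdisj).sum_sepWeight_add hs hs' hN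
  simp only [Finset.sum_add_distrib] at htot
  have hl : ∑ k, ∑ u, ∑ v, sepWeight (edgeRel n D U T) s s' (q - k) u v =
      ∑ x, ∑ u, ∑ v, sepWeight (edgeRel n D U T) s s' x u v :=
    (Equiv.subLeft q).sum_comp fun x => ∑ u, ∑ v, sepWeight (edgeRel n D U T) s s' x u v
  have hr : ∑ k, ∑ u, ∑ v, sepWeight (edgeRel n D U T) s' s (k - q) u v =
      ∑ x, ∑ u, ∑ v, sepWeight (edgeRel n D U T) s' s x u v :=
    (Equiv.subRight q).sum_comp fun x => ∑ u, ∑ v, sepWeight (edgeRel n D U T) s' s x u v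
  rw [Finset.sum_add_distrib, Finset.sum_congr rfl fun k _ => hrot k,
    Finset.sum_congr rfl fun k _ => hrefl k, hl, hr, htot]
  push_cast
  ring

/-- Each of the `2(n+3)` dihedral maps sends internal diagonals to
internal diagonals and preserves crossings, so it maps triangulations to
triangulations; moreover for every triangulation `T` and every `j ∈ [n+1]`,
`∑_{k} ( x_j(ρ_k(T)) + x_j(τ_k(T)) ) = (n+2)(n+3)`, i.e. the barycenter of the
dihedral orbit of `x(T)` has all coordinates `(n+2)/2`. -/
theorem dihedral_orbit_barycenter (n : ℕ) (hn : 1 ≤ n) (D U : Finset ℕ)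
    (hUD : D ∪ U = Finset.Icc 1 (n + 1)) (hdisj : Disjoint D U) :
    (∀ k : ZMod (n + 3), ∀ δ : ℕ × ℕ, IsInternalDiag n D U δ →
      IsInternalDiag n D U (mapDiag (rotMap n D U k) δ) ∧
      IsInternalDiag n D U (mapDiag (reflMap n D U k) δ)) ∧
    (∀ k : ZMod (n + 3), ∀ δ δ' : ℕ × ℕ, Cross n D U δ δ' →
      Cross n D U (mapDiag (rotMap n D U k) δ) (mapDiag (rotMap n D U k) δ') ∧
      Cross n D U (mapDiag (reflMap n D U k) δ) (mapDiag (reflMap n D U k) δ')) ∧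
    (∀ k : ZMod (n + 3), ∀ T : Finset (ℕ × ℕ), IsTriangulation n D U T →
      IsTriangulation n D U (T.image (mapDiag (rotMap n D U k))) ∧
      IsTriangulation n D U (T.image (mapDiag (reflMap n D U k)))) ∧
    (∀ T : Finset (ℕ × ℕ), IsTriangulation n D U T → ∀ j ∈ Finset.Icc 1 (n + 1),
      ∑ k : ZMod (n + 3),
          (xcoord n D U (T.image (mapDiag (rotMap n D U k))) j +
           xcoord n D U (T.image (mapDiag (reflMap n D U k))) j)
        = ((n : ℝ) + 2) * ((n : ℝ) + 3)) := by
  refine ⟨fun k δ hδ => ⟨(isDihedral_add k).isInternalDiag hUD hdisj hδ,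
      (isDihedral_sub k).isInternalDiag hUD hdisj hδ⟩,
    fun k δ δ' hc => ⟨(isDihedral_add k).cross hUD hdisj hc,
      (isDihedral_sub k).cross hUD hdisj hc⟩,
    fun k T hT => ⟨(isDihedral_add k).isTriangulation hUD hdisj hT,
      (isDihedral_sub k).isTriangulation hUD hdisj hT⟩, ?_⟩
  intro T hT j hj
  have hrot : ∀ k : ZMod (n + 3), IsTriangulation n D U (T.image (mapDiag (rotMap n D U k))) :=
    fun k => (isDihedral_add k).isTriangulation hUD hdisj hT
  have hrefl : ∀ k : ZMod (n + 3), IsTriangulation n D U (T.image (mapDiag (reflMap n D U k))) :=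
    fun k => (isDihedral_sub k).isTriangulation hUD hdisj hT
  rw [Finset.mem_Icc] at hj
  rcases mem_or_mem hUD hj.1 hj.2 with hjD | hjU
  · rw [← sum_dihedral_sepWeight hUD hdisj hT (s := n + 2 - j) (s' := j) (by omega) hj.1
      (by omega) (cpos n D U j)]
    exact Finset.sum_congr rfl fun k _ => congrArg₂ _
      (xcoord_of_mem_D hUD hdisj (hrot k) hjD) (xcoord_of_mem_D hUD hdisj (hrefl k) hjD)
  · have hsum := sum_dihedral_sepWeight hUD hdisj hT (s := j) (s' := n + 2 - j) hj.1 (by omega)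
      (by omega) (cpos n D U j)
    have hx := fun k : ZMod (n + 3) => congrArg₂ (· + ·)
      (xcoord_of_mem_U hUD hdisj (hrot k) hjU) (xcoord_of_mem_U hUD hdisj (hrefl k) hjU)
    refine (Finset.sum_congr rfl fun k _ => hx k).trans ?_
    rw [Finset.sum_add_distrib] at hsum ⊢
    rw [Finset.sum_sub_distrib, Finset.sum_sub_distrib, Finset.sum_const, Finset.card_univ,
      ZMod.card, nsmul_eq_mul]
    push_cast
    linarith [hsum]

end Spines
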